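/- arXiv:cs/0208043 — 5 statements merged into one kernel-verified Lean document; each statement's English description precedes it below -/
import Mathlib

section
/- Let 0 ≤ r < t be computable real numbers. Then for every constructive r-supergale d there exists a constructive t-gale d' such that S∞[d] ⊆ S∞[d']. -/
open Filter

/-- The length-`n` prefix `S[0..n-1]` of an infinite binary sequence `S`. -/
def preSeq (S : ℕ → Bool) (n : ℕ) : List Bool := (List.range n).map S

/-- An `s`-supergale: a nonnegative function on binary strings with
    `d w ≥ (d w0 + d w1) / 2^s`. -/
def Supergale (s : ℝ) (d : List Bool → ℝ) : Prop :=
  (∀ w, 0 ≤ d w) ∧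
  ∀ w : List Bool, (d (w ++ [false]) + d (w ++ [true])) / 2 ^ s ≤ d w

/-- An `s`-gale: a nonnegative function on binary strings with
    `d w = (d w0 + d w1) / 2^s`. -/
def Gale (s : ℝ) (d : List Bool → ℝ) : Prop :=
  (∀ w, 0 ≤ d w) ∧
  ∀ w : List Bool, d w = (d (w ++ [false]) + d (w ++ [true])) / 2 ^ s

/-- The success set `S∞[d]`: the sequences on whose prefixes `d` has limsup `∞`. -/
def SuccessSet (d : List Bool → ℝ) : Set (ℕ → Bool) :=
  {S | limsup (fun n => ((d (preSeq S n) : ℝ) : EReal)) atTop = ⊤}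

/-- A real number is computable if some computable rational sequence
    approximates it to within `2 ^ (-n)`. -/
def ComputableReal (r : ℝ) : Prop :=
  ∃ f : ℕ → ℚ, Computable f ∧ ∀ n : ℕ, |(f n : ℝ) - r| ≤ 2 ^ (-(n : ℝ))

/-- A function on binary strings is constructive if it is approximable from
    below by a computable rational function, nondecreasing and strictly below
    `g` in its second argument, with supremum `g w`. -/
def Constructive (g : List Bool → ℝ) : Prop :=
  ∃ h : List Bool × ℕ → ℚ, Computable h ∧
    (∀ w n, h (w, n) ≤ h (w, n + 1) ∧ ((h (w, n) : ℝ) < g w)) ∧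
    ∀ w, g w = ⨆ n : ℕ, ((h (w, n) : ℝ))

theorem exists_computable_choice {α : Type*} [Primcodable α] {P : α → ℕ → Bool}
    (hP : Computable₂ P) (hex : ∀ a, ∃ n, P a n = true) :
    ∃ f : α → ℕ, Computable f ∧ ∀ a, P a (f a) = true := by
  refine ⟨fun a => Nat.find (hex a), Partrec.of_eq_tot
    (f := fun a => Nat.rfind fun n => Part.some (P a n)) (Partrec.rfind hP.partrec₂) fun a => ?_,
    fun a => Nat.find_spec (hex a)⟩
  refine Nat.mem_rfind.2 ⟨?_, fun {m} hm => ?_⟩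
  · rw [Nat.find_spec (hex a)]; exact Part.mem_some _
  · have h := Nat.find_min (hex a) hm
    rw [Bool.not_eq_true] at h
    rw [h]; exact Part.mem_some _

/-- The number of codes of rationals below `n` in the numerator-denominator encoding. -/
def ratCodeRank (n : ℕ) : ℕ :=
  (List.range n).countP fun m =>
    @decide (m ∈ Set.range Rat.instEncodable.encode) (Encodable.decidableRangeEncode ℚ m)

theorem rat_primcodable_encode (q : ℚ) :
    (Primcodable.toEncodable (α := ℚ)).encode q = ratCodeRank (Rat.instEncodable.encode q) := by
  rfl

theorem rat_encode_eq (q : ℚ) :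
    Rat.instEncodable.encode q = Nat.pair (Equiv.intEquivNat q.num) q.den := by
  rfl

theorem intEquivNat_ofNat (n : ℕ) : Equiv.intEquivNat (n : ℤ) = 2 * n := rfl

theorem intEquivNat_negSucc (n : ℕ) : Equiv.intEquivNat (Int.negSucc n) = 2 * n + 1 := rfl

theorem intEquivNat_div (z : ℤ) : (Equiv.intEquivNat z + 1) / 2 = z.natAbs := by
  cases z with
  | ofNat n => rw [Int.ofNat_eq_natCast, intEquivNat_ofNat]; simp; omega
  | negSucc n => rw [intEquivNat_negSucc, Int.natAbs_negSucc]; omega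

open Primrec in
theorem primrecRel_coprime : PrimrecRel (fun a b : ℕ => 0 < b ∧ Nat.Coprime a b) := by
  have h1 : PrimrecRel (fun (x : ℕ) (y : ℕ × ℕ) => ¬ (y.1 % x = 0 ∧ y.2 % x = 0 ∧ 1 < x)) := by
    refine (PrimrecPred.and ?_ (PrimrecPred.and ?_ ?_)).not
    · exact Primrec.eq.comp (nat_mod.comp (fst.comp snd) fst) (const 0)
    · exact Primrec.eq.comp (nat_mod.comp (snd.comp snd) fst) (const 0)
    · exact nat_lt.comp (const 1) fst
  have h2 := h1.forall_mem_list
  refine ((nat_lt.comp (const 0) snd).and (h2.comp (list_range.comp (succ.comp snd)) .id)).of_eq ?_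
  rintro ⟨a, b⟩
  refine and_congr_right fun hb => ?_
  simp only [List.mem_range]
  refine ⟨fun h => ?_, fun h x hx => ?_⟩
  · have := h (a.gcd b) (Nat.lt_succ_of_le (Nat.gcd_le_right _ hb))
    have h0 := Nat.gcd_pos_of_pos_right a hb
    simp only [id, Nat.mod_eq_zero_of_dvd (Nat.gcd_dvd_left a b),
      Nat.mod_eq_zero_of_dvd (Nat.gcd_dvd_right a b), true_and, not_lt] at this
    exact le_antisymm this h0
  · rintro ⟨h3, h4, h5⟩
    have := Nat.dvd_gcd (Nat.dvd_of_mod_eq_zero h3) (Nat.dvd_of_mod_eq_zero h4)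
    have h6 : Nat.gcd a b = 1 := h
    simp only [id, h6] at this
    have := Nat.le_of_dvd one_pos this
    omega

theorem mem_range_rat_encode (m : ℕ) : m ∈ Set.range (Rat.instEncodable.encode) ↔
    0 < m.unpair.2 ∧ Nat.Coprime ((m.unpair.1 + 1) / 2) m.unpair.2 := by
  constructor
  · rintro ⟨q, rfl⟩
    rw [rat_encode_eq]
    simp only [Nat.unpair_pair, intEquivNat_div]
    exact ⟨q.den_pos, q.reduced⟩
  · rintro ⟨h1, h2⟩
    obtain ⟨z, hz⟩ := Equiv.intEquivNat.surjective m.unpair.1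
    rw [← hz, intEquivNat_div] at h2
    refine ⟨⟨z, m.unpair.2, h1.ne', h2⟩, ?_⟩
    rw [rat_encode_eq]
    simp only [hz, Nat.pair_unpair]

theorem primrecPred_mem_range_rat_encode :
    PrimrecPred (fun m : ℕ => m ∈ Set.range (Rat.instEncodable.encode)) := by
  refine (primrecRel_coprime.comp (f := fun m : ℕ => (m.unpair.1 + 1) / 2)
    (g := fun m => m.unpair.2) ?_ ?_).of_eq
    fun m => (mem_range_rat_encode m).symm
  · exact Primrec.nat_div.comp (Primrec.succ.comp (Primrec.fst.comp Primrec.unpair))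
      (Primrec.const 2)
  · exact (Primrec.snd.comp Primrec.unpair)

theorem primrec_ratCodeRank : Primrec ratCodeRank := by
  let (m : ℕ) : Decidable (m ∈ Set.range Rat.instEncodable.encode) :=
    Encodable.decidableRangeEncode ℚ m
  have h := Primrec.listFilter primrecPred_mem_range_rat_encode
  refine (Primrec.list_length.comp (h.comp Primrec.list_range)).of_eq fun n => ?_
  rw [ratCodeRank, List.countP_eq_length_filter]

/-- The rational `(a - b) / (c + 1)` represented by a triple `(a, b, c)` of naturals. -/
def ratMk (x : ℕ × ℕ × ℕ) : ℚ := ((x.1 : ℚ) - x.2.1) / (x.2.2 + 1)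

theorem ratMk_eq_iff (x : ℕ × ℕ × ℕ) (q : ℚ) : ratMk x = q ↔
    q.num.toNat * (x.2.2 + 1) + x.2.1 * q.den = x.1 * q.den + (-q.num).toNat * (x.2.2 + 1) := by
  have h1 : (q.num : ℚ) = q.num.toNat - (-q.num).toNat := by
    have h := Int.toNat_sub_toNat_neg q.num
    exact_mod_cast h.symm
  have h2 : ((x.2.2 : ℚ) + 1) ≠ 0 := by positivity
  have h3 : (q.den : ℚ) ≠ 0 := by exact_mod_cast q.den_nz
  conv_lhs => rw [← Rat.num_div_den q, h1]
  rw [ratMk, div_eq_div_iff h2 h3]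
  rw [← @Nat.cast_inj ℚ]
  push_cast
  constructor <;> intro h <;> linarith

theorem intEquivNat_toNat (z : ℤ) : z.toNat =
    if Equiv.intEquivNat z % 2 = 0 then Equiv.intEquivNat z / 2 else 0 := by
  cases z with
  | ofNat n => rw [Int.ofNat_eq_natCast, intEquivNat_ofNat]; simp
  | negSucc n => rw [intEquivNat_negSucc, if_neg (by omega)]; rfl

theorem intEquivNat_neg_toNat (z : ℤ) : (-z).toNat =
    if Equiv.intEquivNat z % 2 = 0 then 0 else (Equiv.intEquivNat z + 1) / 2 := by
  cases z with
  | ofNat n => rw [Int.ofNat_eq_natCast, intEquivNat_ofNat]; simp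
  | negSucc n => rw [intEquivNat_negSucc, if_neg (by omega), Int.neg_negSucc]; omega

open Primrec in
theorem computable_ratMk : Computable ratMk := by
  classical
  let P : ℕ × ℕ × ℕ → ℕ → Prop := fun x m => m ∈ Set.range (Rat.instEncodable.encode) ∧
    (if m.unpair.1 % 2 = 0 then m.unpair.1 / 2 else 0) * (x.2.2 + 1) + x.2.1 * m.unpair.2 =
    x.1 * m.unpair.2 + (if m.unpair.1 % 2 = 0 then 0 else (m.unpair.1 + 1) / 2) * (x.2.2 + 1)
  have hP : PrimrecRel P := by
    have hu : Primrec fun p : (ℕ × ℕ × ℕ) × ℕ => p.2.unpair.1 :=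
      fst.comp (unpair.comp snd)
    have hv : Primrec fun p : (ℕ × ℕ × ℕ) × ℕ => p.2.unpair.2 :=
      snd.comp (unpair.comp snd)
    have hc : PrimrecPred fun p : (ℕ × ℕ × ℕ) × ℕ => p.2.unpair.1 % 2 = 0 :=
      Primrec.eq.comp (nat_mod.comp hu (const 2)) (const 0)
    have hx : Primrec fun p : (ℕ × ℕ × ℕ) × ℕ => p.1.2.2 + 1 :=
      succ.comp (snd.comp (snd.comp fst))
    refine PrimrecPred.and (primrecPred_mem_range_rat_encode.comp snd) (Primrec.eq.comp ?_ ?_)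
    · exact nat_add.comp (nat_mul.comp (ite hc (nat_div.comp hu (const 2)) (const 0)) hx)
        (nat_mul.comp (fst.comp (snd.comp fst)) hv)
    · exact nat_add.comp (nat_mul.comp (fst.comp fst) hv)
        (nat_mul.comp (ite hc (const 0) (nat_div.comp (succ.comp hu) (const 2))) hx)
  have key (x : ℕ × ℕ × ℕ) (q : ℚ) : P x (Rat.instEncodable.encode q) ↔ ratMk x = q := by
    rw [ratMk_eq_iff, intEquivNat_toNat, intEquivNat_neg_toNat]
    have h : Nat.pair (Equiv.intEquivNat q.num) q.den ∈ Set.range (Rat.instEncodable.encode) :=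
      ⟨q, rfl⟩
    simp only [P, rat_encode_eq, Nat.unpair_pair, h, true_and]
  obtain ⟨f, hf, hPf⟩ := exists_computable_choice (P := fun x m => decide (P x m)) hP.decide.to_comp
    fun x => ⟨Rat.instEncodable.encode (ratMk x), by simp [key]⟩
  refine ((Computable.ofNat ℚ).comp (primrec_ratCodeRank.to_comp.comp hf)).of_eq fun x => ?_
  have hm : P x (f x) := by simpa using hPf x
  obtain ⟨q, hq⟩ := hm.1
  rw [← hq, key] at hm
  rw [hm, ← hq, ← rat_primcodable_encode]
  exact Denumerable.ofNat_encode q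

theorem ratMk_surjective : Function.Surjective ratMk := fun q =>
  ⟨(q.num.toNat, (-q.num).toNat, q.den - 1), by
    rw [ratMk_eq_iff]
    simp only [Nat.sub_add_cancel q.den_pos]⟩

theorem exists_computable_section : ∃ s : ℚ → ℕ × ℕ × ℕ, Computable s ∧ ∀ q, ratMk (s q) = q := by
  classical
  let tr : ℕ → ℕ × ℕ × ℕ := fun n => (n.unpair.1, n.unpair.2.unpair)
  have htr : Computable tr := (Primrec.pair (Primrec.fst.comp Primrec.unpair)
    (Primrec.unpair.comp (Primrec.snd.comp Primrec.unpair))).to_comp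
  have hex (q : ℚ) : ∃ n, ratMk (tr n) = q := by
    obtain ⟨x, hx⟩ := ratMk_surjective q
    refine ⟨Nat.pair x.1 (Nat.pair x.2.1 x.2.2), ?_⟩
    simp only [tr, Nat.unpair_pair]
    exact hx
  obtain ⟨f, hf, hPf⟩ := exists_computable_choice (P := fun q n => decide (ratMk (tr n) = q))
    (Primrec.eq.decide.to_comp.comp ((computable_ratMk.comp htr).comp Computable.snd)
      Computable.fst) (by simpa using hex)
  exact ⟨fun q => tr (f q), htr.comp hf, fun q => by simpa using hPf q⟩

open Computable in
theorem computable₂_rat_of_nat {f : ℚ → ℚ → ℚ} {F : ℕ × ℕ × ℕ → ℕ × ℕ × ℕ → ℕ × ℕ × ℕ}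
    (hF : Primrec₂ F)
    (h : ∀ x y, ratMk (F x y) = f (ratMk x) (ratMk y)) : Computable₂ f := by
  obtain ⟨s, hs, hs'⟩ := exists_computable_section
  refine Computable.of_eq (computable_ratMk.comp (hF.to_comp.comp (hs.comp fst) (hs.comp snd))) ?_
  rintro ⟨p, q⟩
  rw [h, hs', hs']

open Primrec in
theorem computable_rat_mul : Computable₂ ((· * ·) : ℚ → ℚ → ℚ) := by
  refine computable₂_rat_of_nat (F := fun x y => (x.1 * y.1 + x.2.1 * y.2.1,
    x.1 * y.2.1 + x.2.1 * y.1, x.2.2 * y.2.2 + x.2.2 + y.2.2)) ?_ fun x y => ?_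
  · have x1 : Primrec fun p : (ℕ × ℕ × ℕ) × ℕ × ℕ × ℕ => p.1.1 := fst.comp fst
    have x2 : Primrec fun p : (ℕ × ℕ × ℕ) × ℕ × ℕ × ℕ => p.1.2.1 := fst.comp (snd.comp fst)
    have x3 : Primrec fun p : (ℕ × ℕ × ℕ) × ℕ × ℕ × ℕ => p.1.2.2 := snd.comp (snd.comp fst)
    have y1 : Primrec fun p : (ℕ × ℕ × ℕ) × ℕ × ℕ × ℕ => p.2.1 := fst.comp snd
    have y2 : Primrec fun p : (ℕ × ℕ × ℕ) × ℕ × ℕ × ℕ => p.2.2.1 := fst.comp (snd.comp snd)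
    have y3 : Primrec fun p : (ℕ × ℕ × ℕ) × ℕ × ℕ × ℕ => p.2.2.2 := snd.comp (snd.comp snd)
    exact pair (nat_add.comp (nat_mul.comp x1 y1) (nat_mul.comp x2 y2))
      (pair (nat_add.comp (nat_mul.comp x1 y2) (nat_mul.comp x2 y1))
        (nat_add.comp (nat_add.comp (nat_mul.comp x3 y3) x3) y3))
  · simp only [ratMk]
    rw [div_mul_div_comm]
    push_cast
    congr 1 <;> ring

open Primrec in
theorem computable_rat_add : Computable₂ ((· + ·) : ℚ → ℚ → ℚ) := by
  refine computable₂_rat_of_nat (F := fun x y => (x.1 * (y.2.2 + 1) + (x.2.2 + 1) * y.1,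
    x.2.1 * (y.2.2 + 1) + (x.2.2 + 1) * y.2.1, x.2.2 * y.2.2 + x.2.2 + y.2.2)) ?_ fun x y => ?_
  · have x1 : Primrec fun p : (ℕ × ℕ × ℕ) × ℕ × ℕ × ℕ => p.1.1 := fst.comp fst
    have x2 : Primrec fun p : (ℕ × ℕ × ℕ) × ℕ × ℕ × ℕ => p.1.2.1 := fst.comp (snd.comp fst)
    have x3 : Primrec fun p : (ℕ × ℕ × ℕ) × ℕ × ℕ × ℕ => p.1.2.2 := snd.comp (snd.comp fst)
    have y1 : Primrec fun p : (ℕ × ℕ × ℕ) × ℕ × ℕ × ℕ => p.2.1 := fst.comp snd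
    have y2 : Primrec fun p : (ℕ × ℕ × ℕ) × ℕ × ℕ × ℕ => p.2.2.1 := fst.comp (snd.comp snd)
    have y3 : Primrec fun p : (ℕ × ℕ × ℕ) × ℕ × ℕ × ℕ => p.2.2.2 := snd.comp (snd.comp snd)
    exact pair (nat_add.comp (nat_mul.comp x1 (succ.comp y3)) (nat_mul.comp (succ.comp x3) y1))
      (pair (nat_add.comp (nat_mul.comp x2 (succ.comp y3)) (nat_mul.comp (succ.comp x3) y2))
        (nat_add.comp (nat_add.comp (nat_mul.comp x3 y3) x3) y3))
  · simp only [ratMk]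
    rw [div_add_div _ _ (by positivity) (by positivity)]
    push_cast
    congr 1 <;> ring

open Computable in
theorem computable_rat_sub : Computable₂ ((· - ·) : ℚ → ℚ → ℚ) :=
  Computable.of_eq (computable_rat_add.comp fst (computable_rat_mul.comp (const (-1)) snd))
    fun p => by simp [sub_eq_add_neg]

open Computable in
theorem computable_rat_pow : Computable₂ ((· ^ ·) : ℚ → ℕ → ℚ) := by
  refine Computable.of_eq (Computable.nat_rec (f := fun p : ℚ × ℕ => p.2) (g := fun _ => (1 : ℚ))
    (h := fun p q => q.2 * p.1) snd (const 1)
    (computable_rat_mul.comp (snd.comp snd) (fst.comp fst))) ?_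
  rintro ⟨q, n⟩
  induction n with
  | zero => simp
  | succ n ih => simp only at ih ⊢; rw [ih, pow_succ]

open Primrec in
theorem computable_rat_nonneg : Computable fun q : ℚ => decide (0 ≤ q) := by
  obtain ⟨s, hs, hs'⟩ := exists_computable_section
  have h : Primrec fun x : ℕ × ℕ × ℕ => decide (x.2.1 ≤ x.1) :=
    nat_le.decide.comp (fst.comp snd) fst
  refine (h.to_comp.comp hs).of_eq fun q => ?_
  conv_rhs => rw [← hs' q]
  rw [decide_eq_decide, ratMk, le_div_iff₀ (by positivity)]
  simp

open Computable in
theorem computable_rat_le : Computable₂ fun p q : ℚ => decide (p ≤ q) :=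
  (computable_rat_nonneg.comp (computable_rat_sub.comp snd fst)).of_eq fun p => by simp

open Computable in
theorem computable_rat_lt : Computable₂ fun p q : ℚ => decide (p < q) :=
  (Primrec.not.to_comp.comp (computable_rat_le.comp snd fst)).of_eq fun p => by
    rw [← decide_not, decide_eq_decide, not_le]

open Computable in
theorem computable_rat_max : Computable₂ (max : ℚ → ℚ → ℚ) :=
  (Computable.cond computable_rat_le snd fst).of_eq fun p => by
    by_cases h : p.1 ≤ p.2 <;> simp [h, (le_of_not_ge : ¬ p.1 ≤ p.2 → _)]

theorem computable_unit_frac : Computable fun n : ℕ => 1 / ((n : ℚ) + 1) := by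
  refine (computable_ratMk.comp (f := ratMk) (g := fun n : ℕ => (1, 0, n)) ?_).of_eq
    fun n => by simp [ratMk]
  exact (Computable.const 1).pair ((Computable.const 0).pair .id)

open Topology

theorem exists_computable_running_max {c : ℕ → ℚ} (hc : Computable c) :
    ∃ a : ℕ → ℚ, Computable a ∧ Monotone a ∧ 0 ≤ a 0 ∧ (∀ n, c n ≤ a (n + 1)) ∧
      ∀ B : ℝ, 0 ≤ B → (∀ n, (c n : ℝ) ≤ B) → ∀ n, (a n : ℝ) ≤ B := by
  let a : ℕ → ℚ := fun N => Nat.rec 0 (fun i y => max y (c i)) N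
  have hsucc (n : ℕ) : a (n + 1) = max (a n) (c n) := rfl
  have hstep : Computable₂ fun (_ : ℕ) (y : ℕ × ℚ) => max y.2 (c y.1) :=
    computable_rat_max.comp (Computable.snd.comp Computable.snd)
      (hc.comp (Computable.fst.comp Computable.snd))
  have ha : Computable a := Computable.nat_rec .id (.const 0) hstep
  refine ⟨a, ha, monotone_nat_of_le_succ fun n => ?_, le_refl (0 : ℚ), fun n => ?_,
    fun B hB h n => ?_⟩
  · rw [hsucc]; exact le_max_left _ _
  · rw [hsucc]; exact le_max_right _ _
  induction n with
  | zero => exact (Rat.cast_zero (α := ℝ)).trans_le hB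
  | succ n ih => rw [hsucc, Rat.cast_max]; exact max_le ih (h n)

theorem le_two_rpow_of_pow_le {x t : ℝ} {p k : ℕ} (h : x ^ (k + 1) ≤ 2 ^ p)
    (ht : (p : ℝ) / (k + 1) ≤ t) : x ≤ 2 ^ t := by
  refine le_trans ?_ (Real.rpow_le_rpow_of_exponent_le one_le_two ht)
  refine le_of_pow_le_pow_left₀ (Nat.succ_ne_zero k) (by positivity) (h.trans_eq ?_)
  rw [← Real.rpow_natCast, ← Real.rpow_natCast, ← Real.rpow_mul zero_le_two]
  congr 1
  push_cast
  field_simp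

theorem exists_pow_le_of_lt_two_rpow {q : ℚ} {t : ℝ} (h0 : 0 < q) (ht : 0 < t)
    (hq : (q : ℝ) < 2 ^ t) : ∃ p k : ℕ, q ^ (k + 1) ≤ 2 ^ p ∧ (p : ℝ) / (k + 1) < t := by
  have h0' : (0 : ℝ) < q := by exact_mod_cast h0
  have hlog : max 0 (Real.logb 2 q) < t :=
    max_lt ht ((Real.logb_lt_iff_lt_rpow one_lt_two h0').2 hq)
  obtain ⟨z, hz1, hz2⟩ := exists_rat_btwn hlog
  have hz0 : 0 ≤ z := by exact_mod_cast (le_max_left _ _).trans hz1.le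
  obtain ⟨p, hp⟩ := Int.eq_ofNat_of_zero_le (Rat.num_nonneg.2 hz0)
  obtain ⟨k, hk⟩ := Nat.exists_eq_succ_of_ne_zero z.den_nz
  have hz : (z : ℝ) = p / (k + 1) := by
    rw [Rat.cast_def, hp, hk]; simp
  rw [hz] at hz1 hz2
  refine ⟨p, k, ?_, hz2⟩
  have h1 : (q : ℝ) ≤ 2 ^ ((p : ℝ) / (k + 1)) :=
    ((Real.logb_lt_iff_lt_rpow one_lt_two h0').1 ((le_max_right _ _).trans_lt hz1)).le
  have h2 : (q : ℝ) ^ (k + 1) ≤ 2 ^ p := by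
    refine (pow_le_pow_left₀ h0'.le h1 _).trans_eq ?_
    rw [← Real.rpow_natCast, ← Real.rpow_natCast, ← Real.rpow_mul zero_le_two]
    congr 1
    push_cast
    field_simp
  exact_mod_cast h2

/-- For a computable `t > 0`, some computable sequence bounded by `2 ^ t` attains every positive
rational below `2 ^ t`. -/
theorem exists_computable_candidates {t : ℝ} (ht : 0 < t) (hct : ComputableReal t) :
    ∃ c : ℕ → ℚ, Computable c ∧ (∀ i, (c i : ℝ) ≤ 2 ^ t) ∧
      ∀ q : ℚ, 0 < q → (q : ℝ) < 2 ^ t → ∃ i, c i = q := by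
  obtain ⟨f, hf, hft⟩ := hct
  have hft' (n : ℕ) : |(f n : ℝ) - t| ≤ (1 / 2) ^ n := by
    refine (hft n).trans_eq ?_
    rw [Real.rpow_neg zero_le_two, Real.rpow_natCast, one_div, inv_pow]
  let C : ℚ × ℕ × ℕ × ℕ → ℚ := fun y => bif decide (y.1 ^ (y.2.2.1 + 1) ≤ 2 ^ y.2.1) &&
    decide (ratMk (y.2.1, 0, y.2.2.1) + (1 / 2) ^ y.2.2.2 < f y.2.2.2) then y.1 else 0
  have hC : Computable C := by
    have hx : Computable fun y : ℚ × ℕ × ℕ × ℕ => y.1 := Computable.fst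
    have hp : Computable fun y : ℚ × ℕ × ℕ × ℕ => y.2.1 := Computable.fst.comp Computable.snd
    have hk : Computable fun y : ℚ × ℕ × ℕ × ℕ => y.2.2.1 :=
      Computable.fst.comp (Computable.snd.comp Computable.snd)
    have hm : Computable fun y : ℚ × ℕ × ℕ × ℕ => y.2.2.2 :=
      Computable.snd.comp (Computable.snd.comp Computable.snd)
    refine Computable.cond (Primrec.and.to_comp.comp ?_ ?_) hx (.const 0)
    · exact computable_rat_le.comp (computable_rat_pow.comp hx (Computable.succ.comp hk))
        (computable_rat_pow.comp (.const 2) hp)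
    · exact computable_rat_lt.comp (computable_rat_add.comp
        (computable_ratMk.comp (hp.pair ((Computable.const 0).pair hk)))
        (computable_rat_pow.comp (.const (1 / 2)) hm)) (hf.comp hm)
  have hCle (y : ℚ × ℕ × ℕ × ℕ) : (C y : ℝ) ≤ 2 ^ t := by
    obtain ⟨x, p, k, m⟩ := y
    simp only [C]
    cases h : (decide (x ^ (k + 1) ≤ 2 ^ p) &&
      decide (ratMk (p, 0, k) + (1 / 2) ^ m < f m)) with
    | false => simpa using (Real.rpow_pos_of_pos two_pos t).le
    | true =>
      simp only [Bool.and_eq_true, decide_eq_true_eq] at h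
      obtain ⟨h1, h2⟩ := h
      have h1' : (x : ℝ) ^ (k + 1) ≤ 2 ^ p := by exact_mod_cast h1
      have h2' : (p : ℝ) / (k + 1) + (1 / 2) ^ m < f m := by
        have : (((ratMk (p, 0, k) + (1 / 2) ^ m : ℚ)) : ℝ) < f m := by exact_mod_cast h2
        simpa [ratMk] using this
      exact le_two_rpow_of_pow_le h1' (by linarith [(abs_le.1 (hft' m)).2])
  refine ⟨fun i => ((Encodable.decode (α := ℚ × ℕ × ℕ × ℕ)
    (self := Primcodable.toEncodable) i).map C).getD 0, ?_, fun i => ?_, fun q h0 hq => ?_⟩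
  · exact Computable.option_getD (Computable.option_map Computable.decode (hC.comp Computable.snd))
      (.const 0)
  · dsimp only
    generalize Encodable.decode (α := ℚ × ℕ × ℕ × ℕ) (self := Primcodable.toEncodable) i = o
    cases o with
    | none => exact (Rat.cast_zero (α := ℝ)).trans_le (Real.rpow_pos_of_pos two_pos t).le
    | some y => exact hCle y
  · obtain ⟨p, k, h1, h2⟩ := exists_pow_le_of_lt_two_rpow h0 ht hq
    obtain ⟨n, hn⟩ := exists_pow_lt_of_lt_one (half_pos (sub_pos.2 h2))
      (one_half_lt_one (α := ℝ))
    refine ⟨Encodable.encode (self := Primcodable.toEncodable) (q, p, k, n), ?_⟩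
    simp only
    rw [@Encodable.encodek _ Primcodable.toEncodable]
    have h3 : ratMk (p, 0, k) + (1 / 2) ^ n < f n := by
      have h4 := (abs_le.1 (hft' n)).1
      have h5 : (((ratMk (p, 0, k) + (1 / 2) ^ n : ℚ)) : ℝ) < f n := by
        simp only [ratMk, Nat.cast_zero, sub_zero]
        push_cast
        linarith
      exact_mod_cast h5
    simp only [C, Option.map_some, Option.getD_some, h1, h3, decide_true, Bool.and_self, cond_true]

theorem exists_computable_tendsto_two_rpow {t : ℝ} (ht : 0 < t) (hct : ComputableReal t) :
    ∃ a : ℕ → ℚ, Computable a ∧ Monotone a ∧ (∀ n, 0 ≤ a n) ∧ (∀ n, (a n : ℝ) ≤ 2 ^ t) ∧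
      Tendsto (fun n => (a n : ℝ)) atTop (𝓝 (2 ^ t)) := by
  obtain ⟨c, hc, hcle, hcq⟩ := exists_computable_candidates ht hct
  obtain ⟨a, ha, hmono, ha0, hca, hB⟩ := exists_computable_running_max hc
  have hale := hB (2 ^ t) (by positivity) hcle
  refine ⟨a, ha, hmono, fun n => ha0.trans (hmono (Nat.zero_le n)), hale, ?_⟩
  refine tendsto_atTop_isLUB (fun i j h => by exact_mod_cast hmono h) ⟨?_, fun b hb => ?_⟩
  · rintro _ ⟨n, rfl⟩; exact hale n
  have hb' (n : ℕ) : (a n : ℝ) ≤ b := hb ⟨n, rfl⟩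
  refine le_of_forall_rat_lt_imp_le fun q hq => ?_
  rcases le_or_gt q 0 with h0 | h0
  · exact le_trans (by exact_mod_cast h0.trans ha0) (hb' 0)
  · obtain ⟨i, rfl⟩ := hcq q h0 hq
    exact le_trans (by exact_mod_cast hca i) (hb' (i + 1))

theorem length_preSeq (S : ℕ → Bool) (n : ℕ) : (preSeq S n).length = n := by simp [preSeq]

theorem preSeq_succ (S : ℕ → Bool) (n : ℕ) : preSeq S (n + 1) = preSeq S n ++ [S n] := by
  simp [preSeq, List.range_succ]

/-- `w` is an initial segment of the infinite sequence `v000…`. -/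
def PrefixPadded (w v : List Bool) : Prop := w = preSeq (fun i => v.getD i false) w.length

instance (w v : List Bool) : Decidable (PrefixPadded w v) :=
  inferInstanceAs (Decidable (w = preSeq (fun i => v.getD i false) w.length))

theorem prefixPadded_append (w v : List Bool) (b : Bool) :
    PrefixPadded (w ++ [b]) v ↔ PrefixPadded w v ∧ b = v.getD w.length false := by
  unfold PrefixPadded
  rw [List.length_append, List.length_singleton, preSeq_succ]
  constructor
  · intro h
    have := List.append_inj h (by rw [length_preSeq])
    simpa using this
  · rintro ⟨h1, h2⟩
    rw [← h1, ← h2]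

theorem prefixPadded_self (v : List Bool) : PrefixPadded v v := by
  unfold PrefixPadded preSeq
  refine List.ext_getElem (by simp) fun i h1 h2 => ?_
  simp [h1]

theorem computable_prefixPadded :
    Computable₂ fun w v : List Bool => decide (PrefixPadded w v) := by
  have h : Primrec fun p : List Bool × List Bool =>
      (List.range p.1.length).map fun i => p.2.getD i false :=
    Primrec.list_map (Primrec.list_range.comp (Primrec.list_length.comp Primrec.fst))
      ((Primrec.list_getD false).comp (Primrec.snd.comp Primrec.fst) Primrec.snd)
  exact (Primrec.eq.decide.comp Primrec.fst h).to_comp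

/-- The mass that the measure with atoms `M v` at `v000…` gives to the cylinder of `w`. -/
noncomputable def cylinderMass (M : List Bool → ℝ) (w : List Bool) : ℝ :=
  ∑' v, if PrefixPadded w v then M v else 0

theorem summable_cylinderMass {M : List Bool → ℝ} (hM : Summable M) (h0 : ∀ v, 0 ≤ M v)
    (w : List Bool) : Summable fun v => if PrefixPadded w v then M v else 0 := by
  refine Summable.of_nonneg_of_le (fun v => ?_) (fun v => ?_) hM
  · split_ifs
    exacts [h0 v, le_rfl]
  · split_ifs
    exacts [le_rfl, h0 v]

theorem cylinderMass_nonneg {M : List Bool → ℝ} (h0 : ∀ v, 0 ≤ M v) (w : List Bool) :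
    0 ≤ cylinderMass M w :=
  tsum_nonneg fun v => by
    split_ifs
    exacts [h0 v, le_rfl]

theorem cylinderMass_append {M : List Bool → ℝ} (hM : Summable M) (h0 : ∀ v, 0 ≤ M v)
    (w : List Bool) :
    cylinderMass M (w ++ [false]) + cylinderMass M (w ++ [true]) = cylinderMass M w := by
  unfold cylinderMass
  rw [← (summable_cylinderMass hM h0 _).tsum_add (summable_cylinderMass hM h0 _)]
  refine tsum_congr fun v => ?_
  simp only [prefixPadded_append]
  by_cases h : PrefixPadded w v <;> cases v.getD w.length false <;> simp [h]

theorem le_cylinderMass {M : List Bool → ℝ} (hM : Summable M) (h0 : ∀ v, 0 ≤ M v)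
    (w : List Bool) : M w ≤ cylinderMass M w := by
  have h := (summable_cylinderMass hM h0 w).le_tsum w fun v _ => by
    split_ifs
    exacts [h0 v, le_rfl]
  rwa [if_pos (prefixPadded_self w)] at h

theorem gale_cylinderMass {M : List Bool → ℝ} (hM : Summable M) (h0 : ∀ v, 0 ≤ M v) (t : ℝ) :
    Gale t fun w => ((2 : ℝ) ^ t) ^ w.length * cylinderMass M w := by
  refine ⟨fun w => mul_nonneg (by positivity) (cylinderMass_nonneg h0 w), fun w => ?_⟩
  simp only [List.length_append, List.length_singleton]
  rw [← mul_add, cylinderMass_append hM h0, eq_div_iff (by positivity)]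
  ring

/-- The finite set of binary strings of length `n`. -/
def words : ℕ → Finset (List Bool)
  | 0 => {[]}
  | n + 1 => (words n ×ˢ Finset.univ).image fun p => p.1 ++ [p.2]

theorem mem_words {n : ℕ} {v : List Bool} : v ∈ words n ↔ v.length = n := by
  induction n generalizing v with
  | zero => simp [words]
  | succ n ih =>
    simp only [words, Finset.mem_image, Finset.mem_product, Finset.mem_univ, and_true, ih]
    constructor
    · rintro ⟨p, hp, rfl⟩
      simp [hp]
    · intro h
      rcases List.eq_nil_or_concat v with rfl | ⟨u, b, rfl⟩
      · simp at h
      · exact ⟨(u, b), by simpa using h, by simp⟩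

theorem sum_words_succ (f : List Bool → ℝ) (n : ℕ) :
    ∑ v ∈ words (n + 1), f v = ∑ v ∈ words n, (f (v ++ [false]) + f (v ++ [true])) := by
  rw [words, Finset.sum_image, Finset.sum_product]
  · simp [add_comm]
  · rintro ⟨a, b⟩ - ⟨a', b'⟩ - h
    simpa using h

theorem Supergale.sum_words_le {r : ℝ} {d : List Bool → ℝ} (hd : Supergale r d) (n : ℕ) :
    ∑ v ∈ words n, d v ≤ ((2 : ℝ) ^ r) ^ n * d [] := by
  induction n with
  | zero => simp [words]
  | succ n ih =>
    rw [sum_words_succ, pow_succ', mul_assoc]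
    refine le_trans ?_ (mul_le_mul_of_nonneg_left ih (by positivity))
    rw [Finset.mul_sum]
    refine Finset.sum_le_sum fun v _ => ?_
    have := hd.2 v
    rwa [div_le_iff₀' (by positivity)] at this

/-- The mass `β ^ |v|` on the strings where `d` exceeds `1`. -/
noncomputable def exceedMass (d : List Bool → ℝ) (β : ℝ) (v : List Bool) : ℝ :=
  open Classical in if 1 < d v then β ^ v.length else 0

theorem exceedMass_nonneg (d : List Bool → ℝ) {β : ℝ} (hβ : 0 ≤ β) (v : List Bool) :
    0 ≤ exceedMass d β v := by
  unfold exceedMass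
  split_ifs
  exacts [pow_nonneg hβ _, le_rfl]

theorem Supergale.summable_exceedMass {r : ℝ} {d : List Bool → ℝ} (hd : Supergale r d) {β : ℝ}
    (hβ : 0 ≤ β) (hlt : (2 : ℝ) ^ r * β < 1) : Summable (exceedMass d β) := by
  have h2 : (0 : ℝ) ≤ 2 ^ r * β := by positivity
  have hle (v : List Bool) : exceedMass d β v ≤ β ^ v.length * d v := by
    unfold exceedMass
    split_ifs with h
    · exact le_mul_of_one_le_right (pow_nonneg hβ _) h.le
    · exact mul_nonneg (pow_nonneg hβ _) (hd.1 v)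
  have hsum (n : ℕ) : ∑ v ∈ words n, exceedMass d β v ≤ (2 ^ r * β) ^ n * d [] := by
    calc ∑ v ∈ words n, exceedMass d β v ≤ ∑ v ∈ words n, β ^ n * d v :=
          Finset.sum_le_sum fun v hv => by
            rw [← mem_words.1 hv]
            exact hle v
      _ ≤ β ^ n * (((2 : ℝ) ^ r) ^ n * d []) := by
          rw [← Finset.mul_sum]
          exact mul_le_mul_of_nonneg_left (hd.sum_words_le n) (pow_nonneg hβ n)
      _ = (2 ^ r * β) ^ n * d [] := by ring
  have hgeom : Summable fun n : ℕ => (2 ^ r * β) ^ n * d [] :=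
    (summable_geometric_of_lt_one h2 hlt).mul_right _
  refine summable_of_sum_le (exceedMass_nonneg d hβ) (c := ∑' n : ℕ, (2 ^ r * β) ^ n * d [])
    fun F => ?_
  rw [← Finset.sum_fiberwise_of_maps_to (fun v hv => Finset.mem_image_of_mem List.length hv)]
  refine le_trans (Finset.sum_le_sum fun n _ => ?_)
    (hgeom.sum_le_tsum (F.image List.length) fun n _ => mul_nonneg (pow_nonneg h2 n) (hd.1 []))
  refine le_trans (Finset.sum_le_sum_of_subset_of_nonneg (fun v hv => ?_)
    fun v _ _ => exceedMass_nonneg d hβ v) (hsum n)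
  exact mem_words.2 (Finset.mem_filter.1 hv).2

theorem successSet_subset_of_pow_le {d d' : List Bool → ℝ} {c : ℝ} (hc : 1 < c)
    (h : ∀ w, 1 < d w → c ^ w.length ≤ d' w) : SuccessSet d ⊆ SuccessSet d' := by
  intro S hS
  have hfr : ∃ᶠ n in atTop, 1 < d (preSeq S n) := by
    have hlt : ((1 : ℝ) : EReal) < limsup (fun n => ((d (preSeq S n) : ℝ) : EReal)) atTop := by
      rw [show limsup (fun n => ((d (preSeq S n) : ℝ) : EReal)) atTop = ⊤ from hS]
      exact EReal.coe_lt_top 1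
    exact (frequently_lt_of_lt_limsup (by isBoundedDefault) hlt).mono fun n hn =>
      EReal.coe_lt_coe_iff.1 hn
  refine EReal.eq_top_iff_forall_lt _ |>.2 fun C => ?_
  have hev : ∀ᶠ n : ℕ in atTop, C + 1 ≤ c ^ n :=
    (tendsto_pow_atTop_atTop_of_one_lt hc).eventually_ge_atTop _
  refine lt_of_lt_of_le (EReal.coe_lt_coe_iff.2 (lt_add_one C))
    (le_limsup_of_frequently_le ((hfr.and_eventually hev).mono fun n hn => ?_)
      (by isBoundedDefault))
  refine EReal.coe_le_coe_iff.2 (hn.2.trans ?_)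
  simpa [length_preSeq] using h _ hn.1

open Computable in
theorem computable_sum_range {α : Type*} [Primcodable α] {F : α × ℕ → ℚ} (hF : Computable F) :
    Computable fun p : α × ℕ => ∑ i ∈ Finset.range p.2, F (p.1, i) := by
  have hstep : Computable₂ fun (p : α × ℕ) (y : ℕ × ℚ) => y.2 + F (p.1, y.1) :=
    computable_rat_add.comp (snd.comp snd)
      (hF.comp ((fst.comp fst).pair (fst.comp snd)))
  refine (Computable.nat_rec (f := fun p : α × ℕ => p.2) (g := fun _ => (0 : ℚ)) snd (const 0)
    hstep).of_eq ?_
  rintro ⟨a, n⟩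
  induction n with
  | zero => simp
  | succ n ih => rw [Finset.sum_range_succ, ← ih]

theorem exists_computable_enumeration (α : Type*) [Primcodable α] [Inhabited α] :
    ∃ (e : ℕ → α) (c : α → ℕ), Computable e ∧ Computable c ∧ ∀ v, e (c v) = v :=
  ⟨fun i => (Encodable.decode i).getD default, Encodable.encode,
    Computable.option_getD Computable.decode (.const _), Computable.encode,
    fun v => by simp only [Encodable.encodek, Option.getD_some]⟩

theorem hasSum_comp_enumeration {α : Type*} {e : ℕ → α} {c : α → ℕ} (hec : ∀ v, e (c v) = v)
    {g : α → ℝ} (hg : Summable g) :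
    HasSum (fun i => if c (e i) = i then g (e i) else 0) (∑' v, g v) := by
  have hinj : Function.Injective c := Function.LeftInverse.injective hec
  refine (hinj.hasSum_iff fun i hi => if_neg fun h => hi ⟨e i, h⟩).1 ?_
  convert hg.hasSum using 1
  funext v
  simp [hec]

/-- A finite-stage lower bound for `cylinderMass (exceedMass d β) w`, where `h` approximates `d`. -/
def massStage (e : ℕ → List Bool) (c : List Bool → ℕ) (h : List Bool × ℕ → ℚ) (β : ℚ)
    (p : (List Bool × ℕ) × ℕ) : ℚ :=
  if c (e p.2) = p.2 ∧ 1 < h (e p.2, p.1.2) ∧ PrefixPadded p.1.1 (e p.2) then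
    β ^ (e p.2).length else 0

open Computable in
theorem computable_massStage {e : ℕ → List Bool} {c : List Bool → ℕ} {h : List Bool × ℕ → ℚ}
    (he : Computable e) (hc : Computable c) (hh : Computable h) (β : ℚ) :
    Computable (massStage e c h β) := by
  have hv : Computable fun p : (List Bool × ℕ) × ℕ => e p.2 := he.comp snd
  have h1 : Computable fun p : (List Bool × ℕ) × ℕ => decide (c (e p.2) = p.2) :=
    Primrec.eq.decide.to_comp.comp (hc.comp hv) snd
  have h2 : Computable fun p : (List Bool × ℕ) × ℕ => decide (1 < h (e p.2, p.1.2)) :=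
    computable_rat_lt.comp (const 1) (hh.comp (hv.pair (snd.comp fst)))
  have h3 : Computable fun p : (List Bool × ℕ) × ℕ => decide (PrefixPadded p.1.1 (e p.2)) :=
    computable_prefixPadded.comp (fst.comp fst) hv
  refine (Computable.cond (Primrec.and.to_comp.comp h1 (Primrec.and.to_comp.comp h2 h3))
    (computable_rat_pow.comp (const β) (Primrec.list_length.to_comp.comp hv)) (const 0)).of_eq
    fun p => ?_
  simp only [massStage, ← Bool.decide_and, Bool.cond_decide]

theorem massStage_nonneg (e : ℕ → List Bool) (c : List Bool → ℕ) (h : List Bool × ℕ → ℚ) {β : ℚ}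
    (hβ : 0 ≤ β) (p : (List Bool × ℕ) × ℕ) : 0 ≤ massStage e c h β p := by
  rw [massStage]
  split_ifs
  exacts [pow_nonneg hβ _, le_rfl]

theorem massStage_mono (e : ℕ → List Bool) (c : List Bool → ℕ) {h : List Bool × ℕ → ℚ}
    (hh : ∀ v, Monotone fun n => h (v, n)) {β : ℚ} (hβ : 0 ≤ β) (w : List Bool) (i : ℕ) {m n : ℕ}
    (hmn : m ≤ n) : massStage e c h β ((w, m), i) ≤ massStage e c h β ((w, n), i) := by
  by_cases hi : c (e i) = i ∧ 1 < h (e i, m) ∧ PrefixPadded w (e i)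
  · have hi' : c (e i) = i ∧ 1 < h (e i, n) ∧ PrefixPadded w (e i) :=
      ⟨hi.1, hi.2.1.trans_le (hh _ hmn), hi.2.2⟩
    rw [massStage, massStage, if_pos hi, if_pos hi']
  · rw [massStage, if_neg hi]
    exact massStage_nonneg e c h hβ _

theorem eventually_massStage_eq {d : List Bool → ℝ} (e : ℕ → List Bool) (c : List Bool → ℕ)
    {h : List Bool × ℕ → ℚ} (hh : ∀ v, Monotone fun n => h (v, n))
    (hlt : ∀ v n, (h (v, n) : ℝ) < d v) (hsup : ∀ v, d v = ⨆ n : ℕ, (h (v, n) : ℝ)) (β : ℚ)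
    (w : List Bool) (i : ℕ) : ∀ᶠ n in atTop, (massStage e c h β ((w, n), i) : ℝ) =
      if c (e i) = i then if PrefixPadded w (e i) then exceedMass d β (e i) else 0 else 0 := by
  by_cases h1 : 1 < d (e i)
  · have h2 : (1 : ℝ) < ⨆ n : ℕ, (h (e i, n) : ℝ) := hsup (e i) ▸ h1
    obtain ⟨k, hk⟩ := exists_lt_of_lt_ciSup h2
    have hk' : 1 < h (e i, k) := by exact_mod_cast hk
    filter_upwards [eventually_ge_atTop k] with n hn
    have hn' : 1 < h (e i, n) := hk'.trans_le (hh _ hn)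
    simp only [massStage, exceedMass, if_pos h1, hn', true_and]
    by_cases h3 : c (e i) = i <;> by_cases h4 : PrefixPadded w (e i) <;> simp [h3, h4]
  · refine Eventually.of_forall fun n => ?_
    have hn' : ¬ 1 < h (e i, n) := fun hn => h1 <|
      lt_trans (by exact_mod_cast hn) (hlt (e i) n)
    simp [massStage, exceedMass, if_neg h1, hn']

theorem tendsto_sum_range_of_eventually_eq {f : ℕ → ℕ → ℝ} {g : ℕ → ℝ} {s : ℝ} (hg : HasSum g s)
    (h0 : ∀ n i, 0 ≤ f n i) (hmono : ∀ i, Monotone fun n => f n i)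
    (hlim : ∀ i, ∀ᶠ n in atTop, f n i = g i) :
    Tendsto (fun n => ∑ i ∈ Finset.range n, f n i) atTop (𝓝 s) := by
  have hle (n i : ℕ) : f n i ≤ g i := by
    obtain ⟨m, hm1, hm2⟩ := ((hlim i).and (eventually_ge_atTop n)).exists
    exact (hmono i hm2).trans_eq hm1
  have hfin (n : ℕ) : ∑' i, (if i < n then f n i else 0) = ∑ i ∈ Finset.range n, f n i := by
    rw [tsum_eq_sum (s := Finset.range n) fun i hi => if_neg (by simpa using hi)]
    exact Finset.sum_congr rfl fun i hi => if_pos (Finset.mem_range.1 hi)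
  simp only [← hfin]
  rw [← hg.tsum_eq]
  refine tendsto_tsum_of_dominated_convergence hg.summable
    (fun i => tendsto_const_nhds.congr' ?_) (Eventually.of_forall fun n i => ?_)
  · filter_upwards [hlim i, eventually_gt_atTop i] with n h1 h2
    rw [if_pos h2, h1]
  · split_ifs with h2
    · rw [Real.norm_of_nonneg (h0 n i)]; exact hle n i
    · rw [norm_zero]; exact (h0 n i).trans (hle n i)

theorem exists_computable_tendsto_cylinderMass {d : List Bool → ℝ} (hd : Constructive d) {β : ℚ}
    (hβ : 0 ≤ β) (hM : Summable (exceedMass d β)) :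
    ∃ σ : List Bool × ℕ → ℚ, Computable σ ∧ (∀ w, Monotone fun n => σ (w, n)) ∧
      (∀ w n, 0 ≤ σ (w, n)) ∧ ∀ w, Tendsto (fun n => (σ (w, n) : ℝ)) atTop
        (𝓝 (cylinderMass (exceedMass d β) w)) := by
  obtain ⟨h, hh, hlt, hsup⟩ := hd
  obtain ⟨e, c, he, hc, hec⟩ := exists_computable_enumeration (List Bool)
  have hmono (v : List Bool) : Monotone fun n => h (v, n) :=
    monotone_nat_of_le_succ fun n => (hlt v n).1
  have hβ' : (0 : ℝ) ≤ β := Rat.cast_nonneg.2 hβ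
  have h0 := massStage_nonneg e c h hβ
  have hstage := massStage_mono e c hmono hβ
  have hcomp : Computable fun p : List Bool × ℕ =>
      ∑ i ∈ Finset.range p.2, massStage e c h β (p, i) :=
    (computable_sum_range (computable_massStage he hc hh β)).comp
      (g := fun p : List Bool × ℕ => (p, p.2)) (Computable.id.pair Computable.snd)
  refine ⟨_, hcomp, fun w m n hmn => ?_, fun w n => Finset.sum_nonneg fun i _ => h0 _, fun w => ?_⟩
  · exact (Finset.sum_le_sum fun i _ => hstage w i hmn).trans
      (Finset.sum_le_sum_of_subset_of_nonneg (Finset.range_mono hmn) fun i _ _ => h0 _)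
  · simp only [Rat.cast_sum]
    exact tendsto_sum_range_of_eventually_eq
      (hasSum_comp_enumeration hec (summable_cylinderMass hM (exceedMass_nonneg d hβ') w))
      (fun n i => Rat.cast_nonneg.2 (h0 _)) (fun i m n hmn => Rat.cast_le.2 (hstage w i hmn))
      (eventually_massStage_eq e c hmono (fun v n => (hlt v n).2) hsup β w)

theorem constructive_of_tendsto {g : List Bool → ℝ} {s : List Bool × ℕ → ℚ} (hs : Computable s)
    (hmono : ∀ w, Monotone fun n => s (w, n))
    (hlim : ∀ w, Tendsto (fun n => (s (w, n) : ℝ)) atTop (𝓝 (g w))) : Constructive g := by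
  have hmono' (w : List Bool) : Monotone fun n => (s (w, n) : ℝ) :=
    fun m n hmn => Rat.cast_le.2 (hmono w hmn)
  have hanti (n : ℕ) : 1 / (((n + 1 : ℕ) : ℚ) + 1) ≤ 1 / ((n : ℚ) + 1) :=
    one_div_le_one_div_of_le (by positivity) (by push_cast; linarith)
  have hpos (n : ℕ) : (0 : ℝ) < 1 / ((n : ℝ) + 1) := by positivity
  have hlt (w : List Bool) (n : ℕ) : ((s (w, n) - 1 / ((n : ℚ) + 1) : ℚ) : ℝ) < g w := by
    push_cast
    linarith [(hmono' w).ge_of_tendsto (hlim w) n, hpos n]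
  refine ⟨fun p => s p - 1 / ((p.2 : ℚ) + 1),
    computable_rat_sub.comp hs (computable_unit_frac.comp Computable.snd),
    fun w n => ⟨sub_le_sub (hmono w n.le_succ) (hanti n), hlt w n⟩, fun w => ?_⟩
  refine (ciSup_eq_of_forall_le_of_forall_lt_exists_gt (fun n => (hlt w n).le) fun b hb => ?_).symm
  have h := (hlim w).sub (tendsto_one_div_add_atTop_nhds_zero_nat (𝕜 := ℝ))
  rw [sub_zero] at h
  obtain ⟨n, hn⟩ := (h.eventually_const_lt hb).exists
  exact ⟨n, by push_cast; exact hn⟩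

/-- Theorem (Hitchcock). Let `0 ≤ r < t` be computable reals. For every
constructive `r`-supergale `d` there is a constructive `t`-gale `d'` with
`S∞[d] ⊆ S∞[d']`. -/
theorem supergale_to_gale_constructive (r t : ℝ) (hr : 0 ≤ r) (hrt : r < t)
    (hcr : ComputableReal r) (hct : ComputableReal t)
    (d : List Bool → ℝ) (hd : Supergale r d) (hdc : Constructive d) :
    ∃ d' : List Bool → ℝ, Gale t d' ∧ Constructive d' ∧
      SuccessSet d ⊆ SuccessSet d' := by
  have ht : 0 < t := hr.trans_lt hrt
  have hrt' : ((2 : ℝ) ^ t)⁻¹ < ((2 : ℝ) ^ r)⁻¹ :=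
    inv_strictAnti₀ (by positivity) (Real.rpow_lt_rpow_of_exponent_lt one_lt_two hrt)
  obtain ⟨β, hβ1, hβ2⟩ := exists_rat_btwn hrt'
  have hβ : (0 : ℝ) < β := lt_trans (by positivity) hβ1
  have hlt : (2 : ℝ) ^ r * β < 1 := by
    rwa [lt_inv_comm₀ hβ (by positivity), ← one_div, lt_div_iff₀ hβ] at hβ2
  have hgt : 1 < (2 : ℝ) ^ t * β := by
    rwa [inv_lt_iff_one_lt_mul₀ (by positivity), mul_comm] at hβ1
  have hM := hd.summable_exceedMass hβ.le hlt
  have h0 := exceedMass_nonneg d hβ.le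
  obtain ⟨a, ha, hamono, ha0, -, halim⟩ := exists_computable_tendsto_two_rpow ht hct
  obtain ⟨σ, hσ, hσmono, hσ0, hσlim⟩ :=
    exists_computable_tendsto_cylinderMass hdc (by exact_mod_cast hβ.le) hM
  refine ⟨_, gale_cylinderMass hM h0 t, ?_, successSet_subset_of_pow_le hgt fun w hw => ?_⟩
  · refine constructive_of_tendsto (s := fun p => a p.2 ^ p.1.length * σ p) ?_
      (fun w m n hmn => ?_) fun w => ?_
    · exact computable_rat_mul.comp (computable_rat_pow.comp (ha.comp Computable.snd)
        (Primrec.list_length.to_comp.comp Computable.fst)) hσ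
    · exact mul_le_mul (pow_le_pow_left₀ (ha0 m) (hamono hmn) _) (hσmono w hmn) (hσ0 w m)
        (pow_nonneg (ha0 n) _)
    · push_cast
      exact (halim.pow _).mul (hσlim w)
  · rw [mul_pow]
    refine mul_le_mul_of_nonneg_left ?_ (by positivity)
    exact (if_pos hw).symm.trans_le (le_cylinderMass hM h0 w)
end

section
/- Let 0 ≤ r < s < t be real numbers, and for each n ∈ ℕ let A_n be a set of binary strings of length n with |A_n| ≤ 2^{rn}. Define d' : {0,1}* → [0,∞] by d'(w) = Σ_{n=0}^∞ 2^{(s−r)n}·d_{A_n}(w). Then d'(λ) ≤ Σ_{n=0}^∞ 2^{(s−t)n} < ∞, d'(w) < ∞ for every string w, and d' is a t-gale. -/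
open Filter

/-- The `t`-gale `d_F` determined by a set `F` of strings of length `n`:
    `d_F w = 2^{-t(n-|w|)}·|{v ∈ F : w ⊑ v}|` for `|w| ≤ n`, and
    `d_F w = 2^{(t-1)(|w|-n)}·d_F (w[0..n-1])` for `|w| > n`. -/
noncomputable def dF (t : ℝ) (n : ℕ) (F : Set (List Bool)) (w : List Bool) : ℝ :=
  if w.length ≤ n then
    2 ^ (-t * ((n : ℝ) - (w.length : ℝ))) * ({v ∈ F | w <+: v}.ncard : ℝ)
  else
    2 ^ ((t - 1) * ((w.length : ℝ) - (n : ℝ))) * ({v ∈ F | w.take n <+: v}.ncard : ℝ)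

/-- Every string in a set of strings of length `n` that extends a shorter `w` extends exactly one
of `w0` and `w1`. -/
theorem ncard_extensions_eq_add {n : ℕ} {F : Set (List Bool)} (hF : ∀ v ∈ F, v.length = n)
    {w : List Bool} (hw : w.length < n) :
    {v ∈ F | w <+: v}.ncard =
      {v ∈ F | w ++ [false] <+: v}.ncard + {v ∈ F | w ++ [true] <+: v}.ncard := by
  have hfin : F.Finite := (List.finite_length_eq Bool n).subset hF
  rw [← Set.ncard_union_eq _ (hfin.subset (Set.sep_subset _ _)) (hfin.subset (Set.sep_subset _ _))]
  · congr 1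
    ext v
    simp only [Set.mem_union, Set.mem_ofPred_eq, ← and_or_left]
    refine and_congr_right fun hv => ⟨?_, ?_⟩
    · rintro ⟨u, rfl⟩
      have hlen := hF _ hv
      match u with
      | [] => simp at hlen; omega
      | false :: u => exact Or.inl ⟨u, by simp⟩
      | true :: u => exact Or.inr ⟨u, by simp⟩
    · rintro (h | h) <;> exact (List.prefix_append _ _).trans h
  · rw [Set.disjoint_left]
    rintro v ⟨-, u₁, rfl⟩ ⟨-, u₂, h⟩
    simp at h

theorem dF_of_le_length (t : ℝ) {n : ℕ} (F : Set (List Bool)) {w : List Bool}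
    (hw : n ≤ w.length) :
    dF t n F w =
      2 ^ ((t - 1) * ((w.length : ℝ) - (n : ℝ))) * ({v ∈ F | w.take n <+: v}.ncard : ℝ) := by
  rcases hw.eq_or_lt with rfl | h
  · simp [dF]
  · rw [dF, if_neg h.not_ge]

theorem dF_nonneg (t : ℝ) (n : ℕ) (F : Set (List Bool)) (w : List Bool) : 0 ≤ dF t n F w := by
  unfold dF
  split_ifs <;> positivity

theorem gale_dF (t : ℝ) {n : ℕ} {F : Set (List Bool)} (hF : ∀ v ∈ F, v.length = n) :
    Gale t (dF t n F) := by
  refine ⟨dF_nonneg t n F, fun w => ?_⟩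
  rw [eq_div_iff (by positivity)]
  rcases lt_or_ge w.length n with h | h
  · have hlen (b : Bool) : (w ++ [b]).length ≤ n := by simpa using h
    have hpow : (2 : ℝ) ^ (-t * ((n : ℝ) - (w.length : ℝ))) * 2 ^ t =
        2 ^ (-t * ((n : ℝ) - (w.length + 1 : ℝ))) := by
      rw [← Real.rpow_add two_pos]
      congr 1
      ring
    simp only [dF, if_pos h.le, if_pos (hlen _), ncard_extensions_eq_add hF h]
    simp only [List.length_append, List.length_singleton]
    push_cast
    rw [← hpow]
    ring
  · have hlen (b : Bool) : n ≤ (w ++ [b]).length := by simp; omega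
    have hpow : (2 : ℝ) ^ ((t - 1) * ((w.length : ℝ) - (n : ℝ))) * 2 ^ t =
        2 ^ ((t - 1) * ((w.length + 1 : ℝ) - (n : ℝ))) * 2 := by
      rw [← Real.rpow_add two_pos, ← Real.rpow_add_one two_ne_zero]
      congr 1
      ring
    simp only [dF_of_le_length t F h, dF_of_le_length t F (hlen _), List.take_append_of_le_length h,
      List.length_append, List.length_singleton]
    push_cast
    rw [mul_right_comm, hpow]
    ring

theorem dF_nil_le {r t : ℝ} {n : ℕ} {F : Set (List Bool)} (hcard : (F.ncard : ℝ) ≤ 2 ^ (r * n)) :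
    dF t n F [] ≤ 2 ^ ((r - t) * n) := by
  calc dF t n F [] = 2 ^ (-t * n) * (F.ncard : ℝ) := by simp [dF]
    _ ≤ 2 ^ (-t * n) * 2 ^ (r * n) := by gcongr
    _ = 2 ^ ((r - t) * n) := by
      rw [← Real.rpow_add two_pos]
      congr 1
      ring

namespace Gale

variable {t : ℝ}

theorem const_mul {d : List Bool → ℝ} (hd : Gale t d) {c : ℝ} (hc : 0 ≤ c) :
    Gale t (fun w => c * d w) :=
  ⟨fun w => mul_nonneg hc (hd.1 w), fun w => by beta_reduce; rw [hd.2 w]; ring⟩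

theorem le_pow_mul_nil {d : List Bool → ℝ} (hd : Gale t d) (w : List Bool) :
    d w ≤ (2 ^ t) ^ w.length * d [] := by
  induction w using List.reverseRecOn with
  | nil => simp
  | append_singleton w b ih =>
    have h := hd.2 w
    rw [eq_div_iff (by positivity)] at h
    have hle : d (w ++ [b]) ≤ d w * 2 ^ t := by
      cases b
      · linarith [hd.1 (w ++ [true])]
      · linarith [hd.1 (w ++ [false])]
    calc d (w ++ [b]) ≤ d w * 2 ^ t := hle
      _ ≤ (2 ^ t) ^ w.length * d [] * 2 ^ t := by gcongr
      _ = (2 ^ t) ^ (w ++ [b]).length * d [] := by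
        rw [List.length_append, List.length_singleton, pow_succ]
        ring

variable {ι : Type*} {d : ι → List Bool → ℝ}

theorem summable_of_nil (hd : ∀ i, Gale t (d i)) (h : Summable fun i => d i [])
    (w : List Bool) : Summable fun i => d i w :=
  (h.mul_left _).of_nonneg_of_le (fun i => (hd i).1 w) fun i => (hd i).le_pow_mul_nil w

protected theorem tsum (hd : ∀ i, Gale t (d i)) (h : Summable fun i => d i []) :
    Gale t (fun w => ∑' i, d i w) := by
  refine ⟨fun w => tsum_nonneg fun i => (hd i).1 w, fun w => ?_⟩
  rw [← (summable_of_nil hd h _).tsum_add (summable_of_nil hd h _), ← tsum_div_const]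
  exact tsum_congr fun i => (hd i).2 w

end Gale

theorem summable_two_rpow_mul_natCast {a : ℝ} (ha : a < 0) :
    Summable fun n : ℕ => (2 : ℝ) ^ (a * n) := by
  simp_rw [Real.rpow_mul_natCast zero_le_two]
  exact summable_geometric_of_lt_one (by positivity)
    (Real.rpow_lt_one_of_one_lt_of_neg one_lt_two ha)

/-- For `0 ≤ r < s < t` and sets `A n` of strings of length `n` with
`|A n| ≤ 2 ^ (r * n)`, the sum `d' = ∑' n, 2 ^ ((s-r)*n) * dF t n (A n)`
satisfies `d' [] ≤ ∑' n, 2 ^ ((s-t)*n) < ∞`, is finite everywhere, and is a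
`t`-gale. -/
theorem sum_dF_gale (r s t : ℝ) (hr : 0 ≤ r) (hrs : r < s) (hst : s < t)
    (A : ℕ → Set (List Bool))
    (hlen : ∀ n : ℕ, ∀ v ∈ A n, v.length = n)
    (hcard : ∀ n : ℕ, ((A n).ncard : ℝ) ≤ 2 ^ (r * n)) :
    (∑' n : ℕ, ENNReal.ofReal (2 ^ ((s - r) * n) * dF t n (A n) []))
        ≤ ∑' n : ℕ, ENNReal.ofReal ((2 : ℝ) ^ ((s - t) * n)) ∧
    (∑' n : ℕ, ENNReal.ofReal ((2 : ℝ) ^ ((s - t) * n))) < ⊤ ∧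
    (∀ w : List Bool,
      (∑' n : ℕ, ENNReal.ofReal (2 ^ ((s - r) * n) * dF t n (A n) w)) < ⊤) ∧
    Gale t (fun w =>
      (∑' n : ℕ, ENNReal.ofReal (2 ^ ((s - r) * n) * dF t n (A n) w)).toReal) := by
  have hgale (n : ℕ) : Gale t (fun w => 2 ^ ((s - r) * n) * dF t n (A n) w) :=
    (gale_dF t (hlen n)).const_mul (by positivity)
  have hnil (n : ℕ) : 2 ^ ((s - r) * n) * dF t n (A n) [] ≤ (2 : ℝ) ^ ((s - t) * n) := by
    calc 2 ^ ((s - r) * n) * dF t n (A n) []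
        ≤ (2 : ℝ) ^ ((s - r) * n) * 2 ^ ((r - t) * n) := by
          gcongr
          exact dF_nil_le (hcard n)
      _ = 2 ^ ((s - t) * n) := by
          rw [← Real.rpow_add two_pos]
          congr 1
          ring
  have hgeom : Summable fun n : ℕ => (2 : ℝ) ^ ((s - t) * n) :=
    summable_two_rpow_mul_natCast (sub_neg.2 hst)
  have hsum_nil : Summable fun n : ℕ => 2 ^ ((s - r) * n) * dF t n (A n) [] :=
    hgeom.of_nonneg_of_le (fun n => (hgale n).1 []) hnil
  have hsum := Gale.summable_of_nil hgale hsum_nil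
  have htsum (w : List Bool) := ENNReal.ofReal_tsum_of_nonneg (fun n => (hgale n).1 w) (hsum w)
  refine ⟨ENNReal.tsum_le_tsum fun n => ENNReal.ofReal_le_ofReal (hnil n),
    hgeom.tsum_ofReal_lt_top, fun w => (hsum w).tsum_ofReal_lt_top, ?_⟩
  convert Gale.tsum hgale hsum_nil using 2 with w
  rw [← htsum w, ENNReal.toReal_ofReal (tsum_nonneg fun n => (hgale n).1 w)]
end

section
/- Let 0 ≤ r < s < t be real numbers, for each n ∈ ℕ let A_n be a set of binary strings of length n with |A_n| ≤ 2^{rn}, and let d' = Σ_{n=0}^∞ 2^{(s−r)n}·d_{A_n}. If S is an infinite binary sequence such that S[0..n−1] ∈ A_n for infinitely many n, then d'(S[0..n−1]) ≥ 2^{(s−r)n} for each such n, and consequently S ∈ S∞[d']. -/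
open Filter

theorem finite_of_forall_length_eq {F : Set (List Bool)} {n : ℕ} (hF : ∀ v ∈ F, v.length = n) :
    F.Finite :=
  (List.finite_length_eq Bool n).subset hF

theorem dF_le_of_length_le {t c : ℝ} {n : ℕ} {F : Set (List Bool)} {w : List Bool}
    (hF : ∀ v ∈ F, v.length = n) (hc : (F.ncard : ℝ) ≤ c) (hw : w.length ≤ n) :
    dF t n F w ≤ 2 ^ (-t * ((n : ℝ) - (w.length : ℝ))) * c := by
  rw [dF, if_pos hw]
  have h : {v ∈ F | w <+: v}.ncard ≤ F.ncard :=
    Set.ncard_le_ncard (Set.sep_subset _ _) (finite_of_forall_length_eq hF)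
  have h' : ({v ∈ F | w <+: v}.ncard : ℝ) ≤ F.ncard := by exact_mod_cast h
  gcongr
  exact h'.trans hc

theorem one_le_dF_of_mem {t : ℝ} {n : ℕ} {F : Set (List Bool)} {w : List Bool}
    (hF : ∀ v ∈ F, v.length = n) (hw : w ∈ F) : 1 ≤ dF t n F w := by
  have hlen := hF w hw
  have h : 0 < {v ∈ F | w <+: v}.ncard :=
    (Set.ncard_pos ((finite_of_forall_length_eq hF).subset (Set.sep_subset _ _))).2
      ⟨w, hw, List.prefix_refl w⟩
  rw [dF, if_pos hlen.le, hlen, sub_self, mul_zero, Real.rpow_zero, one_mul]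
  exact_mod_cast h

/-- The weighted sum of the gales `dF t n (A n)` converges at every string. -/
theorem summable_rpow_mul_dF {r s t : ℝ} (hst : s < t) {A : ℕ → Set (List Bool)}
    (hlen : ∀ n : ℕ, ∀ v ∈ A n, v.length = n)
    (hcard : ∀ n : ℕ, ((A n).ncard : ℝ) ≤ 2 ^ (r * n)) (w : List Bool) :
    Summable fun n : ℕ => (2 : ℝ) ^ ((s - r) * n) * dF t n (A n) w := by
  have hgeom : Summable fun n : ℕ => (2 : ℝ) ^ (t * w.length) * ((2 : ℝ) ^ (s - t)) ^ n :=
    (summable_geometric_of_lt_one (by positivity)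
      (Real.rpow_lt_one_of_one_lt_of_neg one_lt_two (sub_neg.2 hst))).mul_left _
  refine hgeom.of_norm_bounded_eventually_nat ?_
  filter_upwards [eventually_ge_atTop w.length] with n hn
  rw [Real.norm_of_nonneg (mul_nonneg (by positivity) (dF_nonneg _ _ _ _))]
  calc (2 : ℝ) ^ ((s - r) * n) * dF t n (A n) w
      ≤ 2 ^ ((s - r) * n) * (2 ^ (-t * ((n : ℝ) - (w.length : ℝ))) * 2 ^ (r * n)) := by
        gcongr
        exact dF_le_of_length_le (hlen n) (hcard n) hn
    _ = 2 ^ (t * w.length) * ((2 : ℝ) ^ (s - t)) ^ n := by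
        rw [← Real.rpow_mul_natCast zero_le_two, ← Real.rpow_add two_pos,
          ← Real.rpow_add two_pos, ← Real.rpow_add two_pos]
        ring_nf

theorem mem_successSet_of_frequently {d : List Bool → ℝ} {S : ℕ → Bool} {f : ℕ → ℝ}
    (hf : Tendsto f atTop atTop) (h : ∃ᶠ n in atTop, f n ≤ d (preSeq S n)) :
    S ∈ SuccessSet d := by
  refine EReal.eq_top_iff_forall_lt _ |>.2 fun M => ?_
  have hM : ∃ᶠ n in atTop, ((M + 1 : ℝ) : EReal) ≤ (d (preSeq S n) : ℝ) :=
    (h.and_eventually (hf.eventually_ge_atTop (M + 1))).mono fun n hn =>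
      EReal.coe_le_coe_iff.2 (hn.2.trans hn.1)
  exact (EReal.coe_lt_coe_iff.2 (lt_add_one M)).trans_le (le_limsup_of_frequently_le hM)

/-- With `d' = ∑' n, 2 ^ ((s-r)*n) * dF t n (A n)` as above, if `S` has its
length-`n` prefix in `A n` for infinitely many `n`, then
`d' (S[0..n-1]) ≥ 2 ^ ((s-r)*n)` for each such `n`, and `S ∈ S∞[d']`. -/
theorem sum_dF_success (r s t : ℝ) (hr : 0 ≤ r) (hrs : r < s) (hst : s < t)
    (A : ℕ → Set (List Bool))
    (hlen : ∀ n : ℕ, ∀ v ∈ A n, v.length = n)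
    (hcard : ∀ n : ℕ, ((A n).ncard : ℝ) ≤ 2 ^ (r * n))
    (d' : List Bool → ℝ)
    (hd' : ∀ w : List Bool, d' w = ∑' n : ℕ, 2 ^ ((s - r) * n) * dF t n (A n) w)
    (S : ℕ → Bool)
    (hS : ∀ m : ℕ, ∃ n ≥ m, preSeq S n ∈ A n) :
    (∀ n : ℕ, preSeq S n ∈ A n → 2 ^ ((s - r) * n) ≤ d' (preSeq S n)) ∧
    S ∈ SuccessSet d' := by
  have hle : ∀ n : ℕ, preSeq S n ∈ A n → 2 ^ ((s - r) * n) ≤ d' (preSeq S n) := by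
    intro n hn
    rw [hd']
    calc (2 : ℝ) ^ ((s - r) * n)
        ≤ 2 ^ ((s - r) * n) * dF t n (A n) (preSeq S n) :=
          le_mul_of_one_le_right (by positivity) (one_le_dF_of_mem (hlen n) hn)
      _ ≤ _ := (summable_rpow_mul_dF hst hlen hcard (preSeq S n)).le_tsum n fun m _ =>
          mul_nonneg (by positivity) (dF_nonneg _ _ _ _)
  refine ⟨hle, mem_successSet_of_frequently (f := fun n : ℕ => (2 : ℝ) ^ ((s - r) * n)) ?_
    ((frequently_atTop.2 hS).mono hle)⟩
  simp_rw [Real.rpow_mul_natCast zero_le_two]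
  exact tendsto_pow_atTop_atTop_of_one_lt
    (Real.one_lt_rpow one_lt_two (sub_pos.2 hrs))
end

section
/- Let 0 ≤ r < t be real numbers. For every r-supergale d there exists a t-gale d' such that S∞[d] ⊆ S∞[d']. -/
open Filter

/-- Auxiliary recursion for `slackGale`, on the reversed string. -/
noncomputable def slackGaleRev (t : ℝ) (d : List Bool → ℝ) : List Bool → ℝ
  | [] => d []
  | b :: l => d (l.reverse ++ [b]) +
      (2 ^ t * slackGaleRev t d l - (d (l.reverse ++ [false]) + d (l.reverse ++ [true]))) / 2

/-- The `t`-gale that agrees with `d` at the empty string and splits the slack at every string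
equally between its two children. -/
noncomputable def slackGale (t : ℝ) (d : List Bool → ℝ) (w : List Bool) : ℝ :=
  slackGaleRev t d w.reverse

theorem slackGale_append (t : ℝ) (d : List Bool → ℝ) (w : List Bool) (b : Bool) :
    slackGale t d (w ++ [b]) = d (w ++ [b]) +
      (2 ^ t * slackGale t d w - (d (w ++ [false]) + d (w ++ [true]))) / 2 := by
  simp [slackGale, slackGaleRev]

theorem Supergale.mono {r t : ℝ} (hrt : r ≤ t) {d : List Bool → ℝ} (hd : Supergale r d) :
    Supergale t d := by
  refine ⟨hd.1, fun w => le_trans ?_ (hd.2 w)⟩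
  have := add_nonneg (hd.1 (w ++ [false])) (hd.1 (w ++ [true]))
  gcongr
  norm_num

theorem Supergale.le_slackGale {t : ℝ} {d : List Bool → ℝ} (hd : Supergale t d)
    (w : List Bool) : d w ≤ slackGale t d w := by
  induction w using List.reverseRecOn with
  | nil => exact le_rfl
  | append_singleton w b ih =>
    have hpos : (0 : ℝ) < 2 ^ t := by positivity
    have h := (div_le_iff₀' hpos).1 (hd.2 w)
    have h' := mul_le_mul_of_nonneg_left ih hpos.le
    rw [slackGale_append]
    linarith

theorem Supergale.gale_slackGale {t : ℝ} {d : List Bool → ℝ} (hd : Supergale t d) :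
    Gale t (slackGale t d) := by
  refine ⟨fun w => (hd.1 w).trans (hd.le_slackGale w), fun w => ?_⟩
  have hpos : (0 : ℝ) < 2 ^ t := by positivity
  rw [slackGale_append, slackGale_append, eq_div_iff hpos.ne']
  ring

theorem SuccessSet.mono {d d' : List Bool → ℝ} (h : ∀ w, d w ≤ d' w) :
    SuccessSet d ⊆ SuccessSet d' := by
  intro S hS
  refine top_le_iff.1 (hS.symm.le.trans (limsup_le_limsup (Eventually.of_forall fun n => ?_)))
  exact EReal.coe_le_coe_iff.2 (h _)

/-- Let `0 ≤ r < t`. For every `r`-supergale `d` there exists a `t`-gale `d'`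
such that `S∞[d] ⊆ S∞[d']`. -/
theorem supergale_to_gale (r t : ℝ) (hr : 0 ≤ r) (hrt : r < t)
    (d : List Bool → ℝ) (hd : Supergale r d) :
    ∃ d' : List Bool → ℝ, Gale t d' ∧ SuccessSet d ⊆ SuccessSet d' := by
  have hd' := hd.mono hrt.le
  exact ⟨slackGale t d, hd'.gale_slackGale, SuccessSet.mono hd'.le_slackGale⟩
end

section
/- For every set X of infinite binary sequences, inf{s ∈ [0,∞) : there exists an s-gale d with X ⊆ S∞[d]} = inf{s ∈ [0,∞) : there exists an s-supergale d with X ⊆ S∞[d]}. -/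
open Filter

/-- The gale dominating a supergale `d`, as a function of the reversed string: the excess of
`2 ^ s` times the value at a string over the values of `d` at its two extensions is split evenly
between these extensions. -/
noncomputable def dominatingGaleRev (s : ℝ) (d : List Bool → ℝ) : List Bool → ℝ
  | [] => d []
  | b :: l => d (l.reverse ++ [b]) +
      (2 ^ s * dominatingGaleRev s d l - (d (l.reverse ++ [false]) + d (l.reverse ++ [true]))) / 2

theorem Supergale.le_dominatingGaleRev {s : ℝ} {d : List Bool → ℝ} (hd : Supergale s d)
    (l : List Bool) : d l.reverse ≤ dominatingGaleRev s d l := by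
  induction l with
  | nil => simp [dominatingGaleRev]
  | cons b l ih =>
    have hs : (0 : ℝ) < 2 ^ s := by positivity
    have h := (div_le_iff₀' hs).1 ((hd.2 l.reverse).trans ih)
    rw [List.reverse_cons, dominatingGaleRev]
    linarith

theorem Supergale.exists_gale_ge {s : ℝ} {d : List Bool → ℝ} (hd : Supergale s d) :
    ∃ g, Gale s g ∧ ∀ w, d w ≤ g w := by
  have hle (w : List Bool) : d w ≤ dominatingGaleRev s d w.reverse := by
    simpa using hd.le_dominatingGaleRev w.reverse
  refine ⟨fun w => dominatingGaleRev s d w.reverse,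
    ⟨fun w => (hd.1 w).trans (hle w), fun w => ?_⟩, hle⟩
  have hs : (0 : ℝ) < 2 ^ s := by positivity
  rw [eq_div_iff hs.ne']
  simp only [List.reverse_append, List.reverse_singleton, List.singleton_append,
    dominatingGaleRev, List.reverse_reverse]
  ring

theorem Gale.supergale {s : ℝ} {d : List Bool → ℝ} (hd : Gale s d) : Supergale s d :=
  ⟨hd.1, fun w => (hd.2 w).ge⟩

theorem SuccessSet_mono {d g : List Bool → ℝ} (h : ∀ w, d w ≤ g w) :
    SuccessSet d ⊆ SuccessSet g := by
  intro S hS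
  refine top_le_iff.1 (le_of_eq_of_le (Eq.symm hS) ?_)
  exact limsup_le_limsup (Eventually.of_forall fun n => EReal.coe_le_coe_iff.2 (h _))

/-- The infimum of the `s` with an `s`-gale succeeding on all of `X` equals
the infimum of the `s` with an `s`-supergale succeeding on all of `X`. -/
theorem inf_gale_eq_inf_supergale (X : Set (ℕ → Bool)) :
    sInf {s : ℝ | 0 ≤ s ∧ ∃ d : List Bool → ℝ, Gale s d ∧ X ⊆ SuccessSet d}
      = sInf {s : ℝ | 0 ≤ s ∧ ∃ d : List Bool → ℝ,
          Supergale s d ∧ X ⊆ SuccessSet d} := by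
  congr 1
  ext s
  refine and_congr_right fun _ => ⟨?_, ?_⟩
  · rintro ⟨d, hd, hX⟩
    exact ⟨d, hd.supergale, hX⟩
  · rintro ⟨d, hd, hX⟩
    obtain ⟨g, hg, hle⟩ := hd.exists_gale_ge
    exact ⟨g, hg, hX.trans (SuccessSet_mono hle)⟩
end
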